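/- Two-sided bound on the expected efficiency difference: under the same hypotheses as the efficiency-comparison theorem (K ≥ 2 classes; correct-label coverage of both C_A and C_Ã lying in [1−α, 1−α+1/(n+1)]; random-incorrect-label coverage of C_A lying in [1−α_c^A, 1−α_c^A+1/(n+1)] and of C_Ã lying in [1−α_c^Ã, 1−α_c^Ã+1/(n+1)]), the expected set-size difference satisfies (K−1)(α_c^A − α_c^Ã − 2/(n+1)) ≤ E[|C_Ã(x_{n+1})| − |C_A(x_{n+1})|] ≤ (K−1)(α_c^A − α_c^Ã + 2/(n+1)). -/

import Mathlib

open MeasureTheory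

/-- Fibres of a pair of maps are measurable when the fibres of both components are. -/
lemma measurableSet_prodMk_fiber {Ω ι κ : Type*} [MeasurableSpace Ω] {X : Ω → ι} {Y : Ω → κ}
    (hX : ∀ i, MeasurableSet {ω | X ω = i}) (hY : ∀ k, MeasurableSet {ω | Y ω = k}) (p : ι × κ) :
    MeasurableSet {ω | (X ω, Y ω) = p} := by
  convert (hX p.1).inter (hY p.2) using 1
  ext ω
  simp [Prod.ext_iff]

/-- Expectation of a function of a finitely-valued random variable with measurable fibres. -/
lemma integral_comp_eq_sum_fibers {Ω ι : Type*} [MeasurableSpace Ω] (μ : Measure Ω)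
    [IsFiniteMeasure μ] [Fintype ι] (X : Ω → ι) (hX : ∀ i, MeasurableSet {ω | X ω = i})
    (f : ι → ℝ) :
    Integrable (fun ω => f (X ω)) μ ∧
      ∫ ω, f (X ω) ∂μ = ∑ i, f i * μ.real {ω | X ω = i} := by
  let _ : MeasurableSpace ι := ⊤
  have hXm : Measurable X := measurable_to_countable' hX
  have hint : Integrable f (μ.map X) := Integrable.of_finite
  refine ⟨hint.comp_measurable hXm, ?_⟩
  rw [← integral_map hXm.aemeasurable hint.aestronglyMeasurable, integral_fintype hint]
  refine Finset.sum_congr rfl fun i _ => ?_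
  rw [map_measureReal_apply hXm (measurableSet_singleton i), smul_eq_mul, mul_comm]
  rfl

/-- Probability of an event determined by a finitely-valued random variable. -/
lemma measureReal_setOf_eq_sum_fibers {Ω ι : Type*} [MeasurableSpace Ω] (μ : Measure Ω)
    [IsFiniteMeasure μ] [Fintype ι] (X : Ω → ι) (hX : ∀ i, MeasurableSet {ω | X ω = i})
    (p : ι → Prop) [DecidablePred p] :
    μ.real {ω | p (X ω)} = ∑ i, (if p i then 1 else 0) * μ.real {ω | X ω = i} := by
  let _ : MeasurableSpace ι := ⊤
  have hXm : Measurable X := measurable_to_countable' hX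
  have hp : MeasurableSet {ω | p (X ω)} :=
    hXm (MeasurableSpace.measurableSet_top : MeasurableSet {i | p i})
  rw [← (integral_comp_eq_sum_fibers μ X hX fun i => if p i then 1 else 0).2,
    ← integral_indicator_one hp]
  congr 1 with ω
  simp [Set.indicator_apply]

/-- Under the uniform weight on the labels other than `y`, the mass of `F`, rescaled by `K - 1`,
together with the indicator of `y ∈ F`, is the cardinality of `F`. -/
lemma card_eq_indicator_add_sum_uniform {K : ℕ} (hK : 2 ≤ K) (F : Finset (Fin K)) (y : Fin K) :
    (F.card : ℝ) = (if y ∈ F then 1 else 0) + ((K : ℝ) - 1) *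
      ∑ y', (if y' ∈ F then 1 else 0) * (if y' = y then 0 else ((K : ℝ) - 1)⁻¹) := by
  have hK' : (K : ℝ) - 1 ≠ 0 := by
    have : (2 : ℝ) ≤ K := by exact_mod_cast hK
    linarith
  have hterm : ∀ y' : Fin K, ((K : ℝ) - 1) *
      ((if y' ∈ F then 1 else 0) * (if y' = y then 0 else ((K : ℝ) - 1)⁻¹)) =
      (if y' ∈ F then 1 else 0) - (if y' = y then (if y ∈ F then 1 else 0) else 0) := by
    intro y'
    by_cases h : y' = y
    · subst h; simp
    · by_cases h' : y' ∈ F <;> simp [h, h', hK']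
  rw [Finset.mul_sum, Finset.sum_congr rfl fun y' _ => hterm y', Finset.sum_sub_distrib]
  simp

/-- If `yR` is conditionally uniform on the labels other than `y`, the expected size of the
prediction set `D Z` is the coverage of `y` plus `K - 1` times the coverage of `yR`. -/
lemma integral_card_eq_coverage_add {Ω ι : Type*} [MeasurableSpace Ω] (μ : Measure Ω)
    [IsFiniteMeasure μ] [Fintype ι] {K : ℕ} (hK : 2 ≤ K)
    (y yR : Ω → Fin K) (Z : Ω → ι) (D : ι → Finset (Fin K))
    (hy : ∀ v, MeasurableSet {ω | y ω = v}) (hyR : ∀ v, MeasurableSet {ω | yR ω = v})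
    (hZ : ∀ z, MeasurableSet {ω | Z ω = z})
    (hcond : ∀ v z v', μ.real {ω | ((y ω, Z ω), yR ω) = ((v, z), v')} =
      (if v' = v then 0 else ((K : ℝ) - 1)⁻¹) * μ.real {ω | (y ω, Z ω) = (v, z)}) :
    Integrable (fun ω => ((D (Z ω)).card : ℝ)) μ ∧
      ∫ ω, ((D (Z ω)).card : ℝ) ∂μ =
        μ.real {ω | y ω ∈ D (Z ω)} + ((K : ℝ) - 1) * μ.real {ω | yR ω ∈ D (Z ω)} := by
  have hyZ := measurableSet_prodMk_fiber hy hZ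
  have hyZR := measurableSet_prodMk_fiber hyZ hyR
  have hcard := integral_comp_eq_sum_fibers μ (fun ω => (y ω, Z ω)) hyZ
    (fun p => ((D p.2).card : ℝ))
  have hcov := measureReal_setOf_eq_sum_fibers μ (fun ω => (y ω, Z ω)) hyZ
    (fun p => p.1 ∈ D p.2)
  have hcovR := measureReal_setOf_eq_sum_fibers μ (fun ω => ((y ω, Z ω), yR ω)) hyZR
    (fun p => p.2 ∈ D p.1.2)
  refine ⟨hcard.1, ?_⟩
  rw [hcard.2, hcov, hcovR,
    Fintype.sum_prod_type (α₁ := Fin K × ι) (α₂ := Fin K), Finset.mul_sum, ← Finset.sum_add_distrib]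
  refine Finset.sum_congr rfl fun ⟨v, z⟩ _ => ?_
  simp only [hcond, ← mul_assoc]
  rw [← Finset.sum_mul, ← mul_assoc, ← add_mul]
  exact congrArg (· * _) (card_eq_indicator_add_sum_uniform hK (D z) v)

/-- **Two-sided bound on the expected efficiency difference.**
Under the same hypotheses as the efficiency-comparison theorem (`K ≥ 2` classes;
correct-label coverage of both `C_A` and `C_Ã` lying in `[1-α, 1-α+1/(n+1)]`;
random-incorrect-label coverage of `C_A` in `[1-α_c^A, 1-α_c^A+1/(n+1)]` and of
`C_Ã` in `[1-α_c^Ã, 1-α_c^Ã+1/(n+1)]`; `y_{n+1}^R` conditionally uniform on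
`Y ∖ {y_{n+1}}`), the expected set-size difference satisfies
`(K-1)(α_c^A - α_c^Ã - 2/(n+1)) ≤ E[|C_Ã| - |C_A|] ≤ (K-1)(α_c^A - α_c^Ã + 2/(n+1))`. -/
theorem efficiency_difference_two_sided_bound
    {Ω : Type*} [MeasurableSpace Ω] (ℙ : Measure Ω) [IsProbabilityMeasure ℙ]
    {K : ℕ} (hK : 2 ≤ K) {n : ℕ} (hn : 1 ≤ n)
    (yTest yR : Ω → Fin K) (CA CT : Ω → Finset (Fin K))
    (hyT : ∀ yv : Fin K, MeasurableSet {ω | yTest ω = yv})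
    (hyR : ∀ y' : Fin K, MeasurableSet {ω | yR ω = y'})
    (hCA : ∀ F : Finset (Fin K), MeasurableSet {ω | CA ω = F})
    (hCT : ∀ F : Finset (Fin K), MeasurableSet {ω | CT ω = F})
    -- conditionally on all other randomness, `yR` is uniform on `Y ∖ {yTest}`:
    (hcond : ∀ (yv y' : Fin K) (F G : Finset (Fin K)),
      ℙ {ω | yTest ω = yv ∧ CA ω = F ∧ CT ω = G ∧ yR ω = y'}
        = (if y' = yv then 0 else (((K - 1 : ℕ) : ENNReal))⁻¹)
            * ℙ {ω | yTest ω = yv ∧ CA ω = F ∧ CT ω = G})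
    (α αcA αcT : ℝ)
    (hα : α ∈ Set.Icc (0 : ℝ) 1) (hαcA : αcA ∈ Set.Icc (0 : ℝ) 1)
    (hαcT : αcT ∈ Set.Icc (0 : ℝ) 1)
    (hcovA₁ : 1 - α ≤ (ℙ {ω | yTest ω ∈ CA ω}).toReal)
    (hcovA₂ : (ℙ {ω | yTest ω ∈ CA ω}).toReal ≤ 1 - α + 1 / ((n : ℝ) + 1))
    (hcovT₁ : 1 - α ≤ (ℙ {ω | yTest ω ∈ CT ω}).toReal)
    (hcovT₂ : (ℙ {ω | yTest ω ∈ CT ω}).toReal ≤ 1 - α + 1 / ((n : ℝ) + 1))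
    (hcovRA₁ : 1 - αcA ≤ (ℙ {ω | yR ω ∈ CA ω}).toReal)
    (hcovRA₂ : (ℙ {ω | yR ω ∈ CA ω}).toReal ≤ 1 - αcA + 1 / ((n : ℝ) + 1))
    (hcovRT₁ : 1 - αcT ≤ (ℙ {ω | yR ω ∈ CT ω}).toReal)
    (hcovRT₂ : (ℙ {ω | yR ω ∈ CT ω}).toReal ≤ 1 - αcT + 1 / ((n : ℝ) + 1)) :
    ((K : ℝ) - 1) * (αcA - αcT - 2 / ((n : ℝ) + 1))
        ≤ ∫ ω, (((CT ω).card : ℝ) - ((CA ω).card : ℝ)) ∂ℙ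
      ∧ ∫ ω, (((CT ω).card : ℝ) - ((CA ω).card : ℝ)) ∂ℙ
          ≤ ((K : ℝ) - 1) * (αcA - αcT + 2 / ((n : ℝ) + 1)) := by
  have hZ := measurableSet_prodMk_fiber hCA hCT
  have hcondReal : ∀ v (z : Finset (Fin K) × Finset (Fin K)) v',
      ℙ.real {ω | ((yTest ω, (CA ω, CT ω)), yR ω) = ((v, z), v')} =
        (if v' = v then 0 else ((K : ℝ) - 1)⁻¹) *
          ℙ.real {ω | (yTest ω, (CA ω, CT ω)) = (v, z)} := by
    rintro v ⟨F, G⟩ v'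
    have h := congrArg ENNReal.toReal (hcond v v' F G)
    rw [ENNReal.toReal_mul] at h
    simp only [Prod.mk.injEq, and_assoc, Measure.real]
    rw [h]
    congr 1
    split_ifs
    · simp
    · rw [ENNReal.toReal_inv, ENNReal.toReal_natCast, Nat.cast_sub (by lia), Nat.cast_one]
  obtain ⟨hiA, hA⟩ := integral_card_eq_coverage_add ℙ hK yTest yR (fun ω => (CA ω, CT ω))
    Prod.fst hyT hyR hZ hcondReal
  obtain ⟨hiT, hT⟩ := integral_card_eq_coverage_add ℙ hK yTest yR (fun ω => (CA ω, CT ω))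
    Prod.snd hyT hyR hZ hcondReal
  rw [integral_sub hiT hiA, hA, hT]
  simp only [Measure.real]
  have hK₁ : (1 : ℝ) ≤ (K : ℝ) - 1 := by
    have : (2 : ℝ) ≤ K := by exact_mod_cast hK
    linarith
  have hε : (0 : ℝ) ≤ 1 / ((n : ℝ) + 1) := by positivity
  have hKε := mul_le_mul_of_nonneg_right hK₁ hε
  have hK₀ : (0 : ℝ) ≤ (K : ℝ) - 1 := by linarith
  have h₁ := mul_le_mul_of_nonneg_left (sub_le_sub hcovRT₂ hcovRA₁) hK₀
  have h₂ := mul_le_mul_of_nonneg_left (sub_le_sub hcovRT₁ hcovRA₂) hK₀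
  rw [show (2 : ℝ) / ((n : ℝ) + 1) = 2 * (1 / ((n : ℝ) + 1)) by ring]
  constructor <;> linarith
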